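/- arXiv:2205.02493 — 2 statements merged into one kernel-verified Lean document; each statement's English description precedes it below -/
import Mathlib

section
/- Let d ≥ 1 be an integer, let s < -2/d, and let m, α, R₀ > 0. Consider the radial scaled mean curvature flow ODE R'(t) = -(d/R(t))·((m/α)·R(t)^{-d})^s, i.e. R'(t) = -d·(m/α)^s·R(t)^{-sd-1}. Then there exists no finite T > 0 and no differentiable R : [0,T) → (0,∞) solving this ODE with R(0) = R₀ and R(t) → 0 as t → T⁻. In other words, the radially symmetric solution of the scaled mean curvature flow with g(c) = c^s exists for all times and does not collapse in finite time. -/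
open Set Filter Topology

/-- Along a positive solution of `R' = -K * R ^ p` on `[0, T)`, the quantity `R ^ (1 - p)` is
affine in time. -/
theorem rpow_one_sub_eq_of_hasDerivWithinAt_neg_mul_rpow {K p T : ℝ} {R : ℝ → ℝ}
    (hR : ∀ t ∈ Ico 0 T, 0 < R t ∧ HasDerivWithinAt R (-K * R t ^ p) (Ico 0 T) t)
    {t : ℝ} (ht : t ∈ Ico 0 T) :
    R t ^ (1 - p) = R 0 ^ (1 - p) + K * (p - 1) * t := by
  have hderiv : ∀ x ∈ Ico 0 T, HasDerivWithinAt
      (fun y => R y ^ (1 - p) - K * (p - 1) * y) 0 (Ico 0 T) x := by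
    intro x hx
    obtain ⟨hpos, hd⟩ := hR x hx
    have hcancel : R x ^ p * R x ^ (1 - p - 1) = 1 := by
      rw [← Real.rpow_add hpos]
      simp
    refine ((hd.rpow_const (p := 1 - p) (Or.inl hpos.ne')).sub
      ((hasDerivWithinAt_id x (Ico 0 T)).const_mul (K * (p - 1)))).congr_deriv ?_
    linear_combination K * (p - 1) * hcancel
  have hconst := (convex_Ico 0 T).norm_image_sub_le_of_norm_hasDerivWithin_le (C := 0)
    hderiv (fun _ _ => by simp) (left_mem_Ico.2 (ht.1.trans_lt ht.2)) ht
  simp only [zero_mul, norm_le_zero_iff] at hconst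
  linear_combination hconst

/-- For `p > 1`, a positive solution of `R' = -K * R ^ p` on `[0, T)` does not tend to `0` at the
finite time `T`. -/
theorem not_tendsto_zero_of_hasDerivWithinAt_neg_mul_rpow {K p T : ℝ} {R : ℝ → ℝ}
    (hp : 1 < p) (hT : 0 < T)
    (hR : ∀ t ∈ Ico 0 T, 0 < R t ∧ HasDerivWithinAt R (-K * R t ^ p) (Ico 0 T) t) :
    ¬ Tendsto R (𝓝[<] T) (𝓝 0) := by
  intro hlim
  have hmem : ∀ᶠ t in 𝓝[<] T, t ∈ Ico 0 T := Ico_mem_nhdsLT hT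
  have hlim' : Tendsto R (𝓝[<] T) (𝓝[>] 0) :=
    tendsto_nhdsWithin_iff.2 ⟨hlim, hmem.mono fun t ht => (hR t ht).1⟩
  have htop : Tendsto (fun t => R t ^ (1 - p)) (𝓝[<] T) atTop :=
    (tendsto_rpow_neg_nhdsGT_zero (by linarith)).comp hlim'
  have hfin : Tendsto (fun t => R 0 ^ (1 - p) + K * (p - 1) * t) (𝓝[<] T)
      (𝓝 (R 0 ^ (1 - p) + K * (p - 1) * T)) :=
    tendsto_nhdsWithin_of_tendsto_nhds (Continuous.tendsto (by fun_prop) T)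
  refine not_tendsto_nhds_of_tendsto_atTop htop _ (hfin.congr' ?_)
  filter_upwards [hmem] with t ht
  exact (rpow_one_sub_eq_of_hasDerivWithinAt_neg_mul_rpow hR ht).symm

/-- Let `d ≥ 1`, `s < -2/d` and `m, α, R₀ > 0`. For the radial scaled mean
curvature flow ODE `R' t = -d·(m/α)^s·(R t)^(-s·d - 1)` (real powers) there is no finite
`T > 0` and no differentiable `R : [0,T) → (0,∞)` solving it with `R 0 = R₀` and `R t → 0`
as `t → T⁻`: the radially symmetric solution for `g(c) = c^s` exists for all times and does
not collapse in finite time. -/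
theorem scaled_mcf_radial_no_finite_collapse
    (d : ℕ) (hd : 1 ≤ d) (s : ℝ) (hs : s < -2 / (d : ℝ))
    (m α R₀ : ℝ) (hm : 0 < m) (hα : 0 < α) (hR₀ : 0 < R₀) :
    ¬ ∃ T : ℝ, 0 < T ∧ ∃ R : ℝ → ℝ, R 0 = R₀ ∧
        (∀ t ∈ Set.Ico 0 T, 0 < R t ∧
          HasDerivWithinAt R (-(d : ℝ) * (m / α) ^ s * R t ^ (-(s * (d : ℝ)) - 1))
            (Set.Ico 0 T) t) ∧
        Filter.Tendsto R (nhdsWithin T (Set.Iio T)) (nhds 0) := by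
  rintro ⟨T, hT, R, -, hR, hlim⟩
  have hd' : (0 : ℝ) < d := by exact_mod_cast hd
  have hsd : s * d < -2 := (lt_div_iff₀ hd').1 hs
  refine not_tendsto_zero_of_hasDerivWithinAt_neg_mul_rpow (K := d * (m / α) ^ s)
    (p := -(s * (d : ℝ)) - 1) (by linarith) hT (fun t ht => ?_) hlim
  simpa only [neg_mul] using hR t ht
end

section
/- Let R, ρ₀, K, g_r, ε > 0 and T₀ ∈ (0,1], set g_l := g_r + K, and assume ε·ρ₀ ≤ R/√2 and ε < T₀·K·R / (8·ρ₀·(R² + 2·g_r)). Let φ_l, φ_r : [0,T₀] → ℝ be differentiable with φ_l(0) = φ_r(0) = ε·ρ₀ and suppose that for all t ∈ [0,T₀]: |φ_l'(t) + g_l/(R + ε·ρ₀)| ≤ K/(8R) and |φ_r'(t) - g_r/(R - ε·ρ₀)| ≤ K/(8R). Then -φ_l(T₀) > φ_r(T₀); moreover, since φ_l(0) + φ_r(0) = 2ε·ρ₀ > 0, there exists T₁ ∈ (0,T₀) with φ_l(T₁) + φ_r(T₁) = 0. -/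
/-- The mismatch of the initial speeds of the two sides of a tube of half-thickness
`a` around an arc of radius `R`, with scaling factors `g + K` and `g`. -/
lemma tube_speed_gap_lt {R a K g : ℝ} (hR : 0 < R) (hK : 0 < K) (hg : 0 < g) (ha : 0 < a)
    (haR : 2 * a ^ 2 ≤ R ^ 2) :
    g / (R - a) - (g + K) / (R + a) < 4 * a * g / R ^ 2 - K / (2 * R) := by
  have hlt : a < R := by nlinarith
  have h₁ : g / (R - a) - g / (R + a) ≤ 4 * a * g / R ^ 2 := by
    have hsub : 0 < R - a := sub_pos.2 hlt
    rw [div_sub_div _ _ hsub.ne' (by positivity), div_le_div_iff₀ (by positivity) (by positivity)]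
    nlinarith [mul_nonneg (mul_pos ha hg).le (sub_nonneg.2 haR)]
  have h₂ : K / (2 * R) < K / (R + a) :=
    div_lt_div_of_pos_left hK (by positivity) (by linarith)
  rw [add_div]
  linarith

/-- The quantitative crossing estimate for the formation of
self-intersections. With `g_l = g_r + K`, `ε·ρ₀ ≤ R/√2` and
`ε < T₀·K·R/(8·ρ₀·(R² + 2·g_r))`, if the height functions `φ_l, φ_r` start at `ε·ρ₀` and
their derivatives stay within `K/(8R)` of `-g_l/(R + ε·ρ₀)` and `g_r/(R - ε·ρ₀)`
respectively on `[0,T₀]`, then `-φ_l T₀ > φ_r T₀`; moreover, since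
`φ_l 0 + φ_r 0 = 2ε·ρ₀ > 0`, there is `T₁ ∈ (0,T₀)` with `φ_l T₁ + φ_r T₁ = 0`
(a self-intersection). -/
theorem self_intersection_crossing
    (R ρ₀ K g_r ε T₀ : ℝ)
    (hR : 0 < R) (hρ₀ : 0 < ρ₀) (hK : 0 < K) (hgr : 0 < g_r) (hε : 0 < ε)
    (hT₀ : T₀ ∈ Set.Ioc (0 : ℝ) 1)
    (g_l : ℝ) (hgl : g_l = g_r + K)
    (hε1 : ε * ρ₀ ≤ R / Real.sqrt 2)
    (hε2 : ε < T₀ * K * R / (8 * ρ₀ * (R ^ 2 + 2 * g_r)))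
    (φl φr φl' φr' : ℝ → ℝ)
    (hφl0 : φl 0 = ε * ρ₀) (hφr0 : φr 0 = ε * ρ₀)
    (hφl : ∀ t ∈ Set.Icc 0 T₀, HasDerivWithinAt φl (φl' t) (Set.Icc 0 T₀) t ∧
      |φl' t + g_l / (R + ε * ρ₀)| ≤ K / (8 * R))
    (hφr : ∀ t ∈ Set.Icc 0 T₀, HasDerivWithinAt φr (φr' t) (Set.Icc 0 T₀) t ∧
      |φr' t - g_r / (R - ε * ρ₀)| ≤ K / (8 * R)) :
    -φl T₀ > φr T₀ ∧ ∃ T₁ ∈ Set.Ioo 0 T₀, φl T₁ + φr T₁ = 0 := by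
  obtain ⟨hT, hT1⟩ := hT₀
  subst hgl
  have ha : 0 < ε * ρ₀ := mul_pos hε hρ₀
  have haR : 2 * (ε * ρ₀) ^ 2 ≤ R ^ 2 := by
    have h := pow_le_pow_left₀ ha.le hε1 2
    rw [div_pow, Real.sq_sqrt zero_le_two] at h
    linarith
  have hgap := tube_speed_gap_lt hR hK hgr ha haR
  have hcont : ContinuousOn (fun t => φl t + φr t) (Set.Icc 0 T₀) := fun t ht =>
    ((hφl t ht).1.add (hφr t ht).1).continuousWithinAt
  have hend : φl T₀ + φr T₀ < 0 := by
    obtain ⟨c, hc, hslope⟩ := exists_hasDerivAt_eq_slope (fun t => φl t + φr t)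
      (fun t => φl' t + φr' t) hT hcont fun t ht =>
        ((hφl t (Set.Ioo_subset_Icc_self ht)).1.add
          (hφr t (Set.Ioo_subset_Icc_self ht)).1).hasDerivAt (Icc_mem_nhds ht.1 ht.2)
    have hl := (abs_le.1 (hφl c (Set.Ioo_subset_Icc_self hc)).2).2
    have hr := (abs_le.1 (hφr c (Set.Ioo_subset_Icc_self hc)).2).2
    have hsum : φl T₀ + φr T₀ = 2 * (ε * ρ₀) + (φl' c + φr' c) * T₀ := by
      rw [hslope, hφl0, hφr0]
      field_simp
      ring
    have hspeed : φl' c + φr' c < 4 * (ε * ρ₀) * g_r / R ^ 2 - K / (4 * R) := by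
      have h : K / (8 * R) + K / (8 * R) - K / (2 * R) = -(K / (4 * R)) := by
        field_simp
        ring
      linarith
    have hthin : 2 * (ε * ρ₀) + 4 * (ε * ρ₀) * g_r / R ^ 2 < K / (4 * R) * T₀ := by
      rw [lt_div_iff₀ (by positivity)] at hε2
      have e₁ : 2 * (ε * ρ₀) + 4 * (ε * ρ₀) * g_r / R ^ 2 =
          ε * (8 * ρ₀ * (R ^ 2 + 2 * g_r)) / (4 * R ^ 2) := by
        field_simp
        ring
      have e₂ : K / (4 * R) * T₀ = T₀ * K * R / (4 * R ^ 2) := by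
        field_simp
      rw [e₁, e₂]
      gcongr
    have hle : 4 * (ε * ρ₀) * g_r / R ^ 2 * T₀ ≤ 4 * (ε * ρ₀) * g_r / R ^ 2 :=
      mul_le_of_le_one_right (by positivity) hT1
    have hmul := mul_lt_mul_of_pos_right hspeed hT
    rw [sub_mul] at hmul
    linarith
  refine ⟨by linarith, ?_⟩
  have hstart : 0 < φl 0 + φr 0 := by
    rw [hφl0, hφr0]
    positivity
  exact intermediate_value_Ioo' hT.le hcont ⟨hend, hstart⟩
end
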